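/- Let A : D(A) ⊆ H₀ → H₁ be a densely defined closed linear operator between Hilbert spaces with adjoint A*, and suppose the embedding of D(cA) := D(A) ∩ N(A)^⊥, equipped with the graph norm of A, into H₀ is compact. Then R(A) is closed, the Friedrichs/Poincaré estimate ‖x‖_{H₀} ≤ c‖Ax‖_{H₁} holds on D(cA) with finite best constant c, and the inverse operators (cA)⁻¹ : R(A) → H₀ and (cA*)⁻¹ : R(A*) → H₁ are compact with operator norms ‖(cA)⁻¹‖ = ‖(cA*)⁻¹‖ = c. -/

import Mathlib

open Submodule LinearPMap RealInnerProductSpace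

noncomputable section

/-- The range of a partially defined linear operator, as a submodule. -/
def pRan {E F : Type*} [AddCommGroup E] [Module ℝ E] [AddCommGroup F] [Module ℝ F]
    (A : E →ₗ.[ℝ] F) : Submodule ℝ F :=
  LinearMap.range A.toFun

/-- The kernel of a partially defined linear operator, as a submodule of the ambient space. -/
def pKer {E F : Type*} [AddCommGroup E] [Module ℝ E] [AddCommGroup F] [Module ℝ F]
    (A : E →ₗ.[ℝ] F) : Submodule ℝ E :=
  (LinearMap.ker A.toFun).map A.domain.subtype

variable {H₀ H₁ : Type*}
  [NormedAddCommGroup H₀] [InnerProductSpace ℝ H₀] [CompleteSpace H₀]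
  [NormedAddCommGroup H₁] [InnerProductSpace ℝ H₁] [CompleteSpace H₁]

section Reduced

set_option linter.unusedSectionVars false

variable {A : H₀ →ₗ.[ℝ] H₁}

theorem mem_pKer_iff {E F : Type*} [AddCommGroup E] [Module ℝ E] [AddCommGroup F] [Module ℝ F]
    {A : E →ₗ.[ℝ] F} {x : E} : x ∈ pKer A ↔ ∃ hx : x ∈ A.domain, A ⟨x, hx⟩ = 0 := by
  unfold pKer
  constructor
  · rintro ⟨z, hz, rfl⟩
    exact ⟨z.2, hz⟩
  · rintro ⟨hx, h⟩
    exact ⟨⟨x, hx⟩, h, rfl⟩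

theorem mem_pRan_iff {E F : Type*} [AddCommGroup E] [Module ℝ E] [AddCommGroup F] [Module ℝ F]
    {A : E →ₗ.[ℝ] F} {y : F} : y ∈ pRan A ↔ ∃ x : A.domain, A x = y :=
  Iff.rfl

/-- The graph of a closed operator is sequentially closed. -/
theorem LinearPMap.IsClosed.exists_apply_eq_of_tendsto (hA : A.IsClosed) {u : ℕ → A.domain}
    {x : H₀} {y : H₁} (hx : Filter.Tendsto (fun n => (u n : H₀)) Filter.atTop (nhds x))
    (hy : Filter.Tendsto (fun n => A (u n)) Filter.atTop (nhds y)) :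
    ∃ h : x ∈ A.domain, A ⟨x, h⟩ = y := by
  have hmem : (x, y) ∈ (A.graph : Set (H₀ × H₁)) :=
    _root_.IsClosed.mem_of_tendsto hA (hx.prodMk_nhds hy)
      (Filter.Eventually.of_forall fun n => A.mem_graph (u n))
  obtain ⟨z, hz, hz'⟩ := A.mem_graph_iff.1 hmem
  simp only at hz hz'
  subst hz
  exact ⟨z.2, hz'⟩

theorem isClosed_pKer (hA : A.IsClosed) : IsClosed (pKer A : Set H₀) := by
  refine IsSeqClosed.isClosed fun u x hu hx => ?_
  choose h h0 using fun n => mem_pKer_iff.1 (hu n)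
  refine mem_pKer_iff.2 (hA.exists_apply_eq_of_tendsto (u := fun n => ⟨u n, h n⟩) hx ?_)
  simp [h0]

/-- Every value of a closed operator is attained on the orthogonal complement of the kernel. -/
theorem exists_mem_pKer_orthogonal_apply_eq (hA : A.IsClosed) (x : A.domain) :
    ∃ z : A.domain, (z : H₀) ∈ (pKer A)ᗮ ∧ A z = A x ∧ (x : H₀) - z ∈ pKer A := by
  have : CompleteSpace (pKer A) := (isClosed_pKer hA).completeSpace_coe
  have hp : (pKer A).starProjection (x : H₀) ∈ pKer A := Submodule.starProjection_apply_mem _ _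
  obtain ⟨hd, h0⟩ := mem_pKer_iff.1 hp
  refine ⟨x - ⟨_, hd⟩, ?_, ?_, ?_⟩
  · exact Submodule.sub_starProjection_mem_orthogonal (K := pKer A) (x : H₀)
  · rw [A.map_sub, h0, sub_zero]
  · simp

theorem eq_zero_of_apply_eq_zero {x : A.domain} (hx : (x : H₀) ∈ (pKer A)ᗮ) (h : A x = 0) :
    (x : H₀) = 0 :=
  inner_self_eq_zero.1 (hx _ (mem_pKer_iff.2 ⟨x.2, h⟩))

/-- A compact embedding of the reduced domain yields a Poincaré estimate. -/
theorem exists_norm_le_mul_norm_apply (hA : A.IsClosed)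
    (hcompact : IsCompact (closure {x : H₀ | ∃ hx : x ∈ A.domain,
      x ∈ (pKer A)ᗮ ∧ ‖x‖ ^ 2 + ‖A ⟨x, hx⟩‖ ^ 2 ≤ 1})) :
    ∃ M : ℝ, ∀ x : A.domain, (x : H₀) ∈ (pKer A)ᗮ → ‖(x : H₀)‖ ≤ M * ‖A x‖ := by
  by_contra! hcon
  choose v hv hlt using fun n : ℕ => hcon ((n : ℝ) + 1)
  have hpos (n : ℕ) : 0 < ‖(v n : H₀)‖ := lt_of_le_of_lt (by positivity) (hlt n)
  set u : ℕ → A.domain := fun n => (2 * ‖(v n : H₀)‖)⁻¹ • v n with hu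
  have hu_mem (n : ℕ) : (u n : H₀) ∈ (pKer A)ᗮ := Submodule.smul_mem _ _ (hv n)
  have hu_norm (n : ℕ) : ‖(u n : H₀)‖ = 1 / 2 := by
    have := hpos n
    simp only [hu, Submodule.coe_smul, norm_smul, norm_inv, norm_mul, norm_norm, Real.norm_ofNat]
    field_simp
  have hAu (n : ℕ) : ‖A (u n)‖ ≤ 1 / 2 * (1 / ((n : ℝ) + 1)) := by
    have h1 := hpos n
    have h2 := (hlt n).le
    simp only [hu, A.map_smul, norm_smul, norm_inv, norm_mul, norm_norm, Real.norm_ofNat]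
    rw [inv_mul_le_iff₀ (by positivity)]
    field_simp
    linarith
  have hlim : Filter.Tendsto (fun n => A (u n)) Filter.atTop (nhds 0) := by
    refine squeeze_zero_norm hAu ?_
    simpa only [mul_zero] using
      (tendsto_one_div_add_atTop_nhds_zero_nat (𝕜 := ℝ)).const_mul (1 / 2 : ℝ)
  obtain ⟨x, -, φ, hφ, hx⟩ := hcompact.tendsto_subseq (x := fun n => (u n : H₀)) fun n =>
    subset_closure ⟨(u n).2, hu_mem n, by
      have h1 : (1 : ℝ) / ((n : ℝ) + 1) ≤ 1 := by
        rw [div_le_one (by positivity)]; linarith [(Nat.cast_nonneg n : (0 : ℝ) ≤ n)]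
      have h2 : ‖A (u n)‖ ≤ 1 / 2 := (hAu n).trans (by linarith)
      have h3 := norm_nonneg (A (u n))
      change ‖(u n : H₀)‖ ^ 2 + ‖A (u n)‖ ^ 2 ≤ 1
      rw [hu_norm n]
      nlinarith⟩
  obtain ⟨hd, h0⟩ := hA.exists_apply_eq_of_tendsto (u := u ∘ φ) hx (hlim.comp hφ.tendsto_atTop)
  have hperp : x ∈ (pKer A)ᗮ :=
    (Submodule.isClosed_orthogonal (pKer A)).mem_of_tendsto hx
      (Filter.Eventually.of_forall fun n => hu_mem _)
  have hx0 : x = 0 := eq_zero_of_apply_eq_zero (x := ⟨x, hd⟩) hperp h0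
  have hn : ‖x‖ = 1 / 2 := tendsto_nhds_unique hx.norm (by simp [hu_norm])
  simp [hx0] at hn

/-- A Poincaré estimate on the reduced domain forces the range to be closed. -/
theorem isClosed_pRan (hA : A.IsClosed) {M : ℝ}
    (hM : ∀ x : A.domain, (x : H₀) ∈ (pKer A)ᗮ → ‖(x : H₀)‖ ≤ M * ‖A x‖) :
    IsClosed (pRan A : Set H₁) := by
  refine IsSeqClosed.isClosed fun v y hv hy => ?_
  have hex (n : ℕ) : ∃ z : A.domain, (z : H₀) ∈ (pKer A)ᗮ ∧ A z = v n := by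
    obtain ⟨x, hx⟩ := mem_pRan_iff.1 (hv n)
    obtain ⟨z, hz, hzx, -⟩ := exists_mem_pKer_orthogonal_apply_eq hA x
    exact ⟨z, hz, hzx.trans hx⟩
  choose u hu huv using hex
  have hdist (m n : ℕ) : dist (u m : H₀) (u n) ≤ M * dist (v m) (v n) := by
    have := hM (u m - u n) (Submodule.sub_mem _ (hu m) (hu n))
    rwa [A.map_sub, huv, huv, Submodule.coe_sub, ← dist_eq_norm, ← dist_eq_norm] at this
  have hcauchy : CauchySeq fun n => (u n : H₀) := by
    have hvc := Metric.cauchySeq_iff.1 hy.cauchySeq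
    refine Metric.cauchySeq_iff.2 fun ε hε => ?_
    obtain ⟨N, hN⟩ := hvc (ε / (|M| + 1)) (by positivity)
    refine ⟨N, fun m hm n hn => ?_⟩
    have h1 := hN m hm n hn
    rw [lt_div_iff₀ (by positivity)] at h1
    have h2 := hdist m n
    have h3 : M * dist (v m) (v n) ≤ |M| * dist (v m) (v n) := by gcongr; exact le_abs_self M
    nlinarith [dist_nonneg (x := v m) (y := v n)]
  obtain ⟨x, hx⟩ := cauchySeq_tendsto_of_complete hcauchy
  obtain ⟨hd, h⟩ := hA.exists_apply_eq_of_tendsto hx (by simpa only [huv] using hy)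
  exact ⟨⟨x, hd⟩, h⟩

/-- If `A` satisfies a Poincaré estimate on its reduced domain, the inverse of the reduced operator
is relatively compact as soon as the reduced domain embeds compactly. -/
theorem isCompact_closure_reduced_inverse {M : ℝ}
    (hcompact : IsCompact (closure {x : H₀ | ∃ hx : x ∈ A.domain,
      x ∈ (pKer A)ᗮ ∧ ‖x‖ ^ 2 + ‖A ⟨x, hx⟩‖ ^ 2 ≤ 1}))
    (hM : ∀ x : A.domain, (x : H₀) ∈ (pKer A)ᗮ → ‖(x : H₀)‖ ≤ M * ‖A x‖) (r : ℝ) :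
    IsCompact (closure {x : H₀ | ∃ hx : x ∈ A.domain, x ∈ (pKer A)ᗮ ∧ ‖A ⟨x, hx⟩‖ ≤ r}) := by
  set s : ℝ := (|M| + 1) * (|r| + 1) with hs
  have hspos : 0 < s := by positivity
  refine (hcompact.image (continuous_const_smul s)).closure_of_subset ?_
  rintro x ⟨hx, hperp, hAx⟩
  refine ⟨s⁻¹ • x, subset_closure ⟨A.domain.smul_mem _ hx, Submodule.smul_mem _ _ hperp, ?_⟩,
    smul_inv_smul₀ hspos.ne' x⟩
  have hA' : A ⟨s⁻¹ • x, A.domain.smul_mem _ hx⟩ = s⁻¹ • A ⟨x, hx⟩ := A.map_smul s⁻¹ ⟨x, hx⟩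
  have h1 : ‖x‖ ≤ |M| * |r| := by
    refine (hM ⟨x, hx⟩ hperp).trans ?_
    have := le_abs_self M
    have := le_abs_self r
    gcongr
    exact hAx.trans this
  have h2 : ‖A ⟨x, hx⟩‖ ≤ |r| := hAx.trans (le_abs_self r)
  have h3 := abs_nonneg M
  have h4 := abs_nonneg r
  have h5 := norm_nonneg x
  have h6 := norm_nonneg (A ⟨x, hx⟩)
  rw [hA', norm_smul, norm_smul, norm_inv, Real.norm_of_nonneg hspos.le, mul_pow, mul_pow,
    ← mul_add, inv_pow, inv_mul_le_iff₀ (by positivity), mul_one]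
  have h7 : ‖x‖ + ‖A ⟨x, hx⟩‖ ≤ s := by rw [hs]; nlinarith [mul_nonneg h3 h4]
  nlinarith [mul_nonneg h5 h6]

theorem inner_adjoint_apply (hdense : Dense (A.domain : Set H₀)) (y : (A†).domain)
    (x : A.domain) : ⟪A x, (y : H₁)⟫ = ⟪(x : H₀), A† y⟫ := by
  have := A.adjoint_isFormalAdjoint hdense y x
  rw [real_inner_comm, real_inner_comm (A† y)]
  exact this.symm

theorem pRan_le_pKer_adjoint_orthogonal (hdense : Dense (A.domain : Set H₀)) :
    pRan A ≤ (pKer (A†))ᗮ := by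
  rintro _ ⟨x, rfl⟩ z hz
  obtain ⟨hd, h0⟩ := mem_pKer_iff.1 hz
  have := inner_adjoint_apply hdense ⟨z, hd⟩ x
  rw [h0, inner_zero_right] at this
  rw [real_inner_comm]
  exact this

theorem exists_adjoint_apply_eq (hdense : Dense (A.domain : Set H₀)) {y : H₁} {w : H₀}
    (h : ∀ x : A.domain, ⟪w, (x : H₀)⟫ = ⟪y, A x⟫) :
    ∃ hy : y ∈ (A†).domain, A† ⟨y, hy⟩ = w :=
  ⟨LinearPMap.mem_adjoint_domain_of_exists y ⟨w, h⟩, LinearPMap.adjoint_apply_eq hdense _ h⟩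

theorem pKer_adjoint_orthogonal_eq_pRan (hdense : Dense (A.domain : Set H₀))
    (hran : IsClosed (pRan A : Set H₁)) : (pKer (A†))ᗮ = pRan A := by
  refine le_antisymm ?_ (pRan_le_pKer_adjoint_orthogonal hdense)
  have : CompleteSpace (pRan A) := hran.completeSpace_coe
  rw [← Submodule.orthogonal_orthogonal (pRan A)]
  refine Submodule.orthogonal_le fun z hz => mem_pKer_iff.2 (exists_adjoint_apply_eq hdense ?_)
  intro x
  rw [inner_zero_left, real_inner_comm]
  exact (hz _ ⟨x, rfl⟩).symm

/-- Under a Poincaré estimate, `N(A)ᗮ ∩ D(A)` is contained in the range of the reduced adjoint. -/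
theorem exists_reduced_adjoint_apply_eq (hdense : Dense (A.domain : Set H₀)) (hA : A.IsClosed)
    {M : ℝ} (hM : ∀ x : A.domain, (x : H₀) ∈ (pKer A)ᗮ → ‖(x : H₀)‖ ≤ M * ‖A x‖)
    {w : H₀} (hw : w ∈ (pKer A)ᗮ) :
    ∃ y : (A†).domain, (y : H₁) ∈ (pKer (A†))ᗮ ∧ A† y = w := by
  have : CompleteSpace (pRan A) := (isClosed_pRan hA hM).completeSpace_coe
  have hex (y : pRan A) : ∃ z : A.domain, (z : H₀) ∈ (pKer A)ᗮ ∧ A z = y := by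
    obtain ⟨x, hx⟩ := mem_pRan_iff.1 y.2
    obtain ⟨z, hz, hzx, -⟩ := exists_mem_pKer_orthogonal_apply_eq hA x
    exact ⟨z, hz, hzx.trans hx⟩
  choose T hT hAT using hex
  have hinner {a b : A.domain} (h : A a = A b) : ⟪w, (a : H₀)⟫ = ⟪w, (b : H₀)⟫ := by
    rw [← sub_eq_zero, ← inner_sub_right, real_inner_comm]
    exact hw _ (mem_pKer_iff.2 ⟨(a - b).2, by
      change A (a - b) = 0
      rw [A.map_sub, h, sub_self]⟩)
  let f : pRan A →ₗ[ℝ] ℝ :=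
    { toFun := fun y => ⟪w, (T y : H₀)⟫
      map_add' := fun y z => by
        rw [hinner (b := T y + T z) (by rw [A.map_add, hAT, hAT, hAT]; rfl), Submodule.coe_add,
          inner_add_right]
      map_smul' := fun r y => by
        rw [hinner (b := r • T y) (by rw [A.map_smul, hAT, hAT]; rfl), Submodule.coe_smul,
          real_inner_smul_right]
        rfl }
  let g : StrongDual ℝ (pRan A) := f.mkContinuous (‖w‖ * M) fun y => by
    have h1 := hM (T y) (hT y)
    rw [hAT] at h1
    rw [mul_assoc]
    exact (norm_inner_le_norm w (T y : H₀)).trans (mul_le_mul_of_nonneg_left h1 (norm_nonneg w))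
  set y : pRan A := (InnerProductSpace.toDual ℝ (pRan A)).symm g with hy
  obtain ⟨hd, hyw⟩ := exists_adjoint_apply_eq (A := A) hdense (y := (y : H₁)) (w := w) fun x => by
    have h1 : ⟪y, (⟨A x, ⟨x, rfl⟩⟩ : pRan A)⟫ = g ⟨A x, ⟨x, rfl⟩⟩ :=
      InnerProductSpace.toDual_symm_apply
    exact (hinner (hAT ⟨A x, ⟨x, rfl⟩⟩).symm).trans h1.symm
  exact ⟨⟨y, hd⟩, pRan_le_pKer_adjoint_orthogonal hdense y.2, hyw⟩

/-- A Poincaré estimate for `A` transfers to its adjoint, with the same constant. -/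
theorem norm_le_mul_norm_adjoint_apply (hdense : Dense (A.domain : Set H₀)) (hA : A.IsClosed)
    {M : ℝ} (hM : ∀ x : A.domain, (x : H₀) ∈ (pKer A)ᗮ → ‖(x : H₀)‖ ≤ M * ‖A x‖)
    (y : (A†).domain) (hy : (y : H₁) ∈ (pKer (A†))ᗮ) : ‖(y : H₁)‖ ≤ M * ‖A† y‖ := by
  rw [pKer_adjoint_orthogonal_eq_pRan hdense (isClosed_pRan hA hM)] at hy
  obtain ⟨x', hx'⟩ := mem_pRan_iff.1 hy
  obtain ⟨x, hx, hxx, -⟩ := exists_mem_pKer_orthogonal_apply_eq hA x'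
  rw [hx'] at hxx
  have h1 : ‖(y : H₁)‖ * ‖(y : H₁)‖ ≤ ‖(x : H₀)‖ * ‖A† y‖ := by
    rw [← real_inner_self_eq_norm_mul_norm]
    nth_rewrite 1 [← hxx]
    rw [inner_adjoint_apply hdense]
    exact real_inner_le_norm _ _
  have h2 := hM x hx
  rw [hxx] at h2
  rcases (norm_nonneg (y : H₁)).eq_or_lt with h0 | h0
  · have h4 : (y : H₁) = 0 := norm_eq_zero.1 h0.symm
    have h5 : y = 0 := Subtype.ext h4
    simp [h5]
  · have h3 := mul_le_mul_of_nonneg_right h2 (norm_nonneg (A† y))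
    nlinarith

/-- Conversely, a Poincaré estimate for the adjoint transfers to `A`, with the same constant. -/
theorem norm_le_mul_norm_apply_of_adjoint (hdense : Dense (A.domain : Set H₀)) (hA : A.IsClosed)
    {M C : ℝ} (hC : ∀ x : A.domain, (x : H₀) ∈ (pKer A)ᗮ → ‖(x : H₀)‖ ≤ C * ‖A x‖)
    (hM : ∀ y : (A†).domain, (y : H₁) ∈ (pKer (A†))ᗮ → ‖(y : H₁)‖ ≤ M * ‖A† y‖)
    (x : A.domain) (hx : (x : H₀) ∈ (pKer A)ᗮ) : ‖(x : H₀)‖ ≤ M * ‖A x‖ := by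
  obtain ⟨y, hy, hyx⟩ := exists_reduced_adjoint_apply_eq hdense hA hC hx
  have h1 : ‖(x : H₀)‖ * ‖(x : H₀)‖ ≤ ‖A x‖ * ‖(y : H₁)‖ := by
    rw [← real_inner_self_eq_norm_mul_norm]
    nth_rewrite 2 [← hyx]
    rw [← inner_adjoint_apply hdense]
    exact real_inner_le_norm _ _
  have h2 := hM y hy
  rw [hyx] at h2
  rcases (norm_nonneg (x : H₀)).eq_or_lt with h0 | h0
  · have h4 : (x : H₀) = 0 := norm_eq_zero.1 h0.symm
    have h5 : x = 0 := Subtype.ext h4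
    simp [h5]
  · have h3 := mul_le_mul_of_nonneg_left h2 (norm_nonneg (A x))
    nlinarith

/-- Compactness of the inverse of the reduced operator passes to the reduced adjoint. -/
theorem isCompact_closure_reduced_adjoint_inverse (hdense : Dense (A.domain : Set H₀))
    (hA : A.IsClosed) {M : ℝ}
    (hM : ∀ x : A.domain, (x : H₀) ∈ (pKer A)ᗮ → ‖(x : H₀)‖ ≤ M * ‖A x‖)
    (hinv : ∀ r : ℝ, IsCompact (closure
      {x : H₀ | ∃ hx : x ∈ A.domain, x ∈ (pKer A)ᗮ ∧ ‖A ⟨x, hx⟩‖ ≤ r})) :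
    IsCompact (closure {y : H₁ | ∃ hy : y ∈ (A†).domain,
      y ∈ (pKer (A†))ᗮ ∧ ‖A† ⟨y, hy⟩‖ ≤ 1}) := by
  set S : Set H₁ := {y : H₁ | ∃ hy : y ∈ (A†).domain, y ∈ (pKer (A†))ᗮ ∧ ‖A† ⟨y, hy⟩‖ ≤ 1}
  set X : Set H₀ := {x : H₀ | ∃ hx : x ∈ A.domain, x ∈ (pKer A)ᗮ ∧ A ⟨x, hx⟩ ∈ S} with hX
  have hXtb : TotallyBounded X := by
    refine (hinv |M|).totallyBounded.subset (Set.Subset.trans ?_ subset_closure)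
    rintro x ⟨hx, hperp, hy, hyperp, hle⟩
    refine ⟨hx, hperp, (norm_le_mul_norm_adjoint_apply hdense hA hM ⟨_, hy⟩ hyperp).trans ?_⟩
    have h1 := le_abs_self M
    have h2 := abs_nonneg M
    have h3 := norm_nonneg (A† ⟨_, hy⟩)
    nlinarith
  have hkey {a b : A.domain} (ha : A a ∈ S) (hb : A b ∈ S) :
      dist (A a) (A b) ^ 2 ≤ 2 * dist (a : H₀) b := by
    obtain ⟨ha, -, ha1⟩ := ha
    obtain ⟨hb, -, hb1⟩ := hb
    have h1 := inner_adjoint_apply hdense (⟨A a, ha⟩ - ⟨A b, hb⟩) (a - b)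
    rw [(A†).map_sub, A.map_sub, Submodule.coe_sub, Submodule.coe_sub,
      real_inner_self_eq_norm_sq] at h1
    rw [dist_eq_norm, dist_eq_norm, h1, mul_comm]
    refine (real_inner_le_norm _ _).trans (mul_le_mul_of_nonneg_left ?_ (norm_nonneg _))
    exact (norm_sub_le _ _).trans (by linarith)
  suffices TotallyBounded S from this.closure.isCompact_of_isClosed isClosed_closure
  refine Metric.totallyBounded_iff.2 fun ε hε => ?_
  obtain ⟨t, htX, htfin, hcover⟩ :=
    Metric.finite_approx_of_totallyBounded hXtb (ε ^ 2 / 2) (by positivity)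
  choose! T hT using fun x (hx : x ∈ t) => show ∃ z : H₁, ∃ h : x ∈ A.domain,
    A ⟨x, h⟩ = z ∧ z ∈ S from let ⟨h, _, hS⟩ := htX hx; ⟨_, h, rfl, hS⟩
  refine ⟨T '' t, htfin.image T, fun y hy => ?_⟩
  have hyran : y ∈ pRan A := by
    rw [← pKer_adjoint_orthogonal_eq_pRan hdense (isClosed_pRan hA hM)]
    exact hy.2.1
  obtain ⟨x', hx'⟩ := mem_pRan_iff.1 hyran
  obtain ⟨x, hx, hxx, -⟩ := exists_mem_pKer_orthogonal_apply_eq hA x'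
  rw [hx'] at hxx
  have hAxS : A x ∈ S := by rwa [hxx]
  obtain ⟨z, hz, hxz⟩ := Set.mem_iUnion₂.1 (hcover (show (x : H₀) ∈ X from ⟨x.2, hx, hAxS⟩))
  obtain ⟨hzd, hzT, hzS⟩ := hT z hz
  refine Set.mem_iUnion₂.2 ⟨T z, Set.mem_image_of_mem T hz, ?_⟩
  rw [← hzT] at hzS ⊢
  have h1 := hkey hAxS hzS
  have h2 : dist (x : H₀) z < ε ^ 2 / 2 := hxz
  rw [hxx] at h1
  rw [Metric.mem_ball]
  exact lt_of_pow_lt_pow_left₀ 2 hε.le (by linarith)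

end Reduced

/-- If the embedding of `D(cA) = D(A) ∩ N(A)^⊥` (with the graph norm) into `H₀`
is compact (i.e. the graph-norm unit ball of `D(cA)` is relatively compact in `H₀`), then `R(A)`
is closed, the Friedrichs/Poincaré estimate holds with finite best constant `c`, and the inverses
`(cA)⁻¹ : R(A) → H₀` and `(cA†)⁻¹ : R(A†) → H₁` are compact with operator norms equal to `c`. -/
theorem statement3 (A : H₀ →ₗ.[ℝ] H₁) (hdense : Dense (A.domain : Set H₀))
    (hclosed : A.IsClosed)
    (hcompact : IsCompact (closure {x : H₀ | ∃ hx : x ∈ A.domain,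
      x ∈ (pKer A)ᗮ ∧ ‖x‖ ^ 2 + ‖A ⟨x, hx⟩‖ ^ 2 ≤ 1}))
    (c : ℝ)
    (hc : c = sSup {r : ℝ | ∃ x : A.domain,
      (x : H₀) ∈ (pKer A)ᗮ ∧ (x : H₀) ≠ 0 ∧ r = ‖(x : H₀)‖ / ‖A x‖}) :
    -- the range is closed
    IsClosed (pRan A : Set H₁)
    -- the Friedrichs/Poincaré estimate holds on `D(cA)` with (finite) best constant `c`
    ∧ (∀ x : A.domain, (x : H₀) ∈ (pKer A)ᗮ → ‖(x : H₀)‖ ≤ c * ‖A x‖)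
    -- `(cA)⁻¹ : R(A) → H₀` is compact: the image of the unit ball of `R(A)` is rel. compact
    ∧ IsCompact (closure {x : H₀ | ∃ hx : x ∈ A.domain,
        x ∈ (pKer A)ᗮ ∧ ‖A ⟨x, hx⟩‖ ≤ 1})
    -- `(cA†)⁻¹ : R(A†) → H₁` is compact
    ∧ IsCompact (closure {y : H₁ | ∃ hy : y ∈ (A†).domain,
        y ∈ (pKer (A†))ᗮ ∧ ‖A† ⟨y, hy⟩‖ ≤ 1})
    -- the operator norm of `(cA)⁻¹` equals `c`
    ∧ IsLeast {M : ℝ | 0 ≤ M ∧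
        ∀ x : A.domain, (x : H₀) ∈ (pKer A)ᗮ → ‖(x : H₀)‖ ≤ M * ‖A x‖} c
    -- the operator norm of `(cA†)⁻¹` equals `c` as well
    ∧ IsLeast {M : ℝ | 0 ≤ M ∧
        ∀ y : (A†).domain, (y : H₁) ∈ (pKer (A†))ᗮ → ‖(y : H₁)‖ ≤ M * ‖A† y‖} c := by
  obtain ⟨M, hM⟩ := exists_norm_le_mul_norm_apply hclosed hcompact
  set Q : Set ℝ := {r : ℝ | ∃ x : A.domain,
    (x : H₀) ∈ (pKer A)ᗮ ∧ (x : H₀) ≠ 0 ∧ r = ‖(x : H₀)‖ / ‖A x‖} with hQ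
  have hpos {x : A.domain} (hx : (x : H₀) ∈ (pKer A)ᗮ) (h0 : (x : H₀) ≠ 0) : 0 < ‖A x‖ :=
    norm_pos_iff.2 fun h => h0 (eq_zero_of_apply_eq_zero hx h)
  have hub {N : ℝ} (hN : ∀ x : A.domain, (x : H₀) ∈ (pKer A)ᗮ → ‖(x : H₀)‖ ≤ N * ‖A x‖) :
      ∀ r ∈ Q, r ≤ N := by
    rintro r ⟨x, hx, h0, rfl⟩
    exact (div_le_iff₀ (hpos hx h0)).2 (hN x hx)
  have hc0 : 0 ≤ c := by
    rw [hc]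
    refine Real.sSup_nonneg ?_
    rintro r ⟨x, -, -, rfl⟩
    positivity
  have hest : ∀ x : A.domain, (x : H₀) ∈ (pKer A)ᗮ → ‖(x : H₀)‖ ≤ c * ‖A x‖ := by
    intro x hx
    by_cases h0 : (x : H₀) = 0
    · rw [h0, norm_zero]
      positivity
    · rw [← div_le_iff₀ (hpos hx h0), hc]
      exact le_csSup ⟨M, hub hM⟩ ⟨x, hx, h0, rfl⟩
  have hleast {N : ℝ} (hN0 : 0 ≤ N)
      (hN : ∀ x : A.domain, (x : H₀) ∈ (pKer A)ᗮ → ‖(x : H₀)‖ ≤ N * ‖A x‖) : c ≤ N := by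
    rw [hc]
    exact Real.sSup_le (hub hN) hN0
  have hinv := isCompact_closure_reduced_inverse hcompact hest
  exact ⟨isClosed_pRan hclosed hest, hest, hinv 1,
    isCompact_closure_reduced_adjoint_inverse hdense hclosed hest hinv,
    ⟨⟨hc0, hest⟩, fun N hN => hleast hN.1 hN.2⟩,
    ⟨hc0, norm_le_mul_norm_adjoint_apply hdense hclosed hest⟩,
    fun N hN => hleast hN.1 (norm_le_mul_norm_apply_of_adjoint hdense hclosed hest hN.2)⟩
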